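/- arXiv:2505.19589 — 8 statements merged into one kernel-verified Lean document; each statement's English description precedes it below -/
import Mathlib

section
/- Let n ≥ 2 and K ≥ 1 be integers, let {1,…,n} be partitioned into folds I_1,…,I_K with k(i) the fold index of i. Let (Γ_i)_{i=1}^n, (Γ'_i)_{i=1}^n be reals with |Γ_i| ≤ M and |Γ'_i| ≤ M for all i (M ≥ 0), let i₀ ∈ {1,…,n}, and let Δ_eq, Δ_neq ≥ 0 satisfy: (1) |Γ_{i₀} − Γ'_{i₀}| ≤ Δ_eq; (2) Γ_j = Γ'_j for every j ∈ I_{k(i₀)} with j ≠ i₀; (3) (1/n)·Σ_{j ∉ I_{k(i₀)}} |Γ_j − Γ'_j| ≤ Δ_neq/K. Define τ̂ = (1/n)Σ_i Γ_i, V̂ = (1/(n−1))Σ_i (Γ_i − τ̂)², and τ̂', V̂' analogously from (Γ'_i). Then |√V̂ − √V̂'| ≤ √(2n/(n−1)) · ( 2√M·(Δ_eq/n + Δ_neq/K)^{1/2} + Δ_eq/n + Δ_neq/K ). -/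
open Finset

lemma aux_tri {n : ℕ} (a b : Fin n → ℝ) :
    |Real.sqrt (∑ i, a i ^ 2) - Real.sqrt (∑ i, b i ^ 2)| ≤ Real.sqrt (∑ i, (a i - b i) ^ 2) := by
  have h := abs_norm_sub_norm_le (WithLp.toLp 2 a : EuclideanSpace ℝ (Fin n)) (WithLp.toLp 2 b)
  simpa [EuclideanSpace.norm_eq, sq_abs] using h

lemma aux_center {n : ℕ} (hn : (n : ℝ) ≠ 0) (d : Fin n → ℝ) :
    ∑ i, (d i - (1 / (n : ℝ)) * ∑ j, d j) ^ 2 ≤ ∑ i, d i ^ 2 := by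
  set m := (1 / (n : ℝ)) * ∑ j, d j with hm
  have hs : ∑ j, d j = n * m := by rw [hm]; field_simp
  have : ∑ i, (d i - m) ^ 2 = ∑ i, d i ^ 2 - n * m ^ 2 := by
    have e : ∀ i, (d i - m) ^ 2 = d i ^ 2 - 2 * m * d i + m ^ 2 := fun i => by ring
    simp only [e, sum_add_distrib, sum_sub_distrib, ← mul_sum, hs]
    simp
    ring
  rw [this]
  have : 0 ≤ (n : ℝ) * m ^ 2 := by positivity
  linarith

/-- Unified sensitivity analysis (Proposition C.1, second part): bound on the
sensitivity of the square root of the empirical variance estimator. -/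
theorem stmt_1 (n K : ℕ) (hn : 2 ≤ n) (hK : 1 ≤ K)
    (fold : Fin n → Fin K) (Γ Γ' : Fin n → ℝ) (M : ℝ) (hM : 0 ≤ M)
    (hbound : ∀ i, |Γ i| ≤ M) (hbound' : ∀ i, |Γ' i| ≤ M)
    (i₀ : Fin n) (Δeq Δneq : ℝ) (hΔeq : 0 ≤ Δeq) (hΔneq : 0 ≤ Δneq)
    (h1 : |Γ i₀ - Γ' i₀| ≤ Δeq)
    (h2 : ∀ j, fold j = fold i₀ → j ≠ i₀ → Γ j = Γ' j)
    (h3 : (1 / (n : ℝ)) * ∑ j ∈ univ.filter (fun j => fold j ≠ fold i₀), |Γ j - Γ' j|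
            ≤ Δneq / (K : ℝ)) :
    |Real.sqrt ((1 / ((n : ℝ) - 1)) * ∑ i, (Γ i - (1 / (n : ℝ)) * ∑ j, Γ j) ^ 2)
        - Real.sqrt ((1 / ((n : ℝ) - 1)) * ∑ i, (Γ' i - (1 / (n : ℝ)) * ∑ j, Γ' j) ^ 2)|
      ≤ Real.sqrt (2 * (n : ℝ) / ((n : ℝ) - 1)) *
          (2 * Real.sqrt M * Real.sqrt (Δeq / (n : ℝ) + Δneq / (K : ℝ))
            + (Δeq / (n : ℝ) + Δneq / (K : ℝ))) := by
  have hn2 : (2 : ℝ) ≤ n := by exact_mod_cast hn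
  have hn0 : (0 : ℝ) < n := by linarith
  have hn1 : (0 : ℝ) < (n : ℝ) - 1 := by linarith
  have hK0 : (0 : ℝ) < K := by exact_mod_cast hK
  set D := Δeq / (n : ℝ) + Δneq / (K : ℝ) with hD
  have hD0 : 0 ≤ D := by positivity
  have hsum : ∑ j, |Γ j - Γ' j| ≤ n * D := by
    rw [← sum_filter_add_sum_filter_not univ (fun j => fold j ≠ fold i₀)]
    have e1 : ∑ j ∈ univ.filter (fun j => ¬ (fold j ≠ fold i₀)), |Γ j - Γ' j|
        = |Γ i₀ - Γ' i₀| := by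
      apply sum_eq_single i₀
      · intro j hj hne
        rw [h2 j (by simpa using hj) hne]; simp
      · intro h; simp at h
    rw [e1]
    have e2 : (n : ℝ) * D = Δeq + n * (Δneq / K) := by rw [hD]; field_simp
    have e3 := mul_le_mul_of_nonneg_left h3 hn0.le
    rw [← mul_assoc, mul_one_div_cancel hn0.ne', one_mul] at e3
    linarith
  have hsq : ∑ j, (Γ j - Γ' j) ^ 2 ≤ 2 * M * (n * D) := by
    calc ∑ j, (Γ j - Γ' j) ^ 2 ≤ ∑ j, 2 * M * |Γ j - Γ' j| := by
          apply sum_le_sum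
          intro j _
          rw [← sq_abs, sq]
          apply mul_le_mul_of_nonneg_right _ (abs_nonneg _)
          have := abs_sub (Γ j) (Γ' j)
          linarith [hbound j, hbound' j]
      _ ≤ _ := by
          rw [← mul_sum]
          exact mul_le_mul_of_nonneg_left hsum (by positivity)
  have hc := aux_center hn0.ne' (fun i => Γ i - Γ' i)
  have ht := aux_tri (fun i => Γ i - (1 / (n : ℝ)) * ∑ j, Γ j)
    (fun i => Γ' i - (1 / (n : ℝ)) * ∑ j, Γ' j)
  have he : ∑ i, ((Γ i - (1 / (n : ℝ)) * ∑ j, Γ j) - (Γ' i - (1 / (n : ℝ)) * ∑ j, Γ' j)) ^ 2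
      = ∑ i, ((Γ i - Γ' i) - (1 / (n : ℝ)) * ∑ j, (Γ j - Γ' j)) ^ 2 := by
    apply sum_congr rfl
    intro i _
    rw [sum_sub_distrib]; ring
  simp only [he] at ht
  have h1n : 0 ≤ 1 / ((n : ℝ) - 1) := by positivity
  rw [Real.sqrt_mul h1n, Real.sqrt_mul h1n, ← mul_sub, abs_mul, abs_of_nonneg (Real.sqrt_nonneg _)]
  have hA : √(1 / ((n : ℝ) - 1)) * √(2 * M * (n * D))
      = √(2 * (n : ℝ) / ((n : ℝ) - 1)) * (√M * √D) := by
    rw [← Real.sqrt_mul h1n, ← Real.sqrt_mul hM, ← Real.sqrt_mul (by positivity)]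
    congr 1; ring
  refine (mul_le_mul_of_nonneg_left (ht.trans (Real.sqrt_le_sqrt (hc.trans hsq)))
    (Real.sqrt_nonneg _)).trans ?_
  rw [hA]
  apply mul_le_mul_of_nonneg_left _ (Real.sqrt_nonneg _)
  have : 0 ≤ √M * √D := by positivity
  linarith
end

section
/- Let K ≥ 1 be an integer, 𝒦 ⊆ {1,…,K}, k₀ ∈ 𝒦, κ ∈ {1,…,K} with κ ≠ k₀, and set S = 𝒦 \ {κ}, s = |S| ≥ 1 (so k₀ ∈ S). Let (a_k) and (a'_k) be positive reals with 1/a_k ≤ M and 1/a'_k ≤ M for all k (M > 0), and with a_k = a'_k for every k ≠ k₀. Assume additionally that the leave-one-out averaged inverse C := (1/s) Σ_{k∈S, k≠k₀} 1/a_k satisfies C ≥ 1/M. Define the harmonic means H = ( (1/s) Σ_{k∈S} 1/a_k )^{-1} and H' = ( (1/s) Σ_{k∈S} 1/a'_k )^{-1}. Then |H − H'| ≤ M³/s. -/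
open Finset

/-- Aggregator sensitivity lemma (Lemma C.2, 'Harmonic mean (2)'). -/
theorem stmt_5 (K : ℕ) (hK : 1 ≤ K) (𝒦 : Finset (Fin K)) (k₀ : Fin K) (hk₀ : k₀ ∈ 𝒦)
    (κ : Fin K) (hκ : κ ≠ k₀)
    (a a' : Fin K → ℝ) (M : ℝ) (hM : 0 < M)
    (hapos : ∀ k, 0 < a k) (ha'pos : ∀ k, 0 < a' k)
    (hainv : ∀ k, 1 / a k ≤ M) (ha'inv : ∀ k, 1 / a' k ≤ M)
    (hagree : ∀ k, k ≠ k₀ → a k = a' k)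
    (hs : 1 ≤ (𝒦.erase κ).card)
    (hC : 1 / M ≤ (1 / ((𝒦.erase κ).card : ℝ)) * ∑ k ∈ (𝒦.erase κ).erase k₀, 1 / a k) :
    |((1 / ((𝒦.erase κ).card : ℝ)) * ∑ k ∈ 𝒦.erase κ, 1 / a k)⁻¹
        - ((1 / ((𝒦.erase κ).card : ℝ)) * ∑ k ∈ 𝒦.erase κ, 1 / a' k)⁻¹|
      ≤ M ^ 3 / ((𝒦.erase κ).card : ℝ) := by
  have hmem : k₀ ∈ 𝒦.erase κ := Finset.mem_erase.mpr ⟨hκ.symm, hk₀⟩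
  have hs' : (0 : ℝ) < ((𝒦.erase κ).card : ℝ) := by exact_mod_cast hs
  have e : ∑ k ∈ (𝒦.erase κ).erase k₀, 1 / a' k = ∑ k ∈ (𝒦.erase κ).erase k₀, 1 / a k :=
    Finset.sum_congr rfl fun k hk => by rw [hagree k (Finset.ne_of_mem_erase hk)]
  rw [← Finset.add_sum_erase _ (fun k => 1 / a k) hmem,
    ← Finset.add_sum_erase _ (fun k => 1 / a' k) hmem, e]
  have hx : 0 < 1 / a k₀ := one_div_pos.mpr (hapos k₀)
  have hy : 0 < 1 / a' k₀ := one_div_pos.mpr (ha'pos k₀)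
  have hxM := hainv k₀
  have hyM := ha'inv k₀
  generalize 1 / a k₀ = x at *
  generalize 1 / a' k₀ = y at *
  generalize ∑ k ∈ (𝒦.erase κ).erase k₀, 1 / a k = T at *
  generalize ((𝒦.erase κ).card : ℝ) = s at *
  have hc : 0 < 1 / s := one_div_pos.mpr hs'
  have hM' : 0 < 1 / M := one_div_pos.mpr hM
  have key : ∀ z : ℝ, 0 < z → 0 < 1 / s * (z + T) ∧ (1 / s * (z + T))⁻¹ ≤ M := by
    intro z hz
    have h1 : 1 / M ≤ 1 / s * (z + T) := by
      have := mul_pos hc hz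
      rw [mul_add]; linarith
    refine ⟨lt_of_lt_of_le hM' h1, ?_⟩
    have := inv_anti₀ hM' h1
    simpa using this
  obtain ⟨hP, hPM⟩ := key x hx
  obtain ⟨hQ, hQM⟩ := key y hy
  have hd : (1 / s * (x + T))⁻¹ - (1 / s * (y + T))⁻¹
      = (1 / s * (y - x)) * ((1 / s * (x + T))⁻¹ * (1 / s * (y + T))⁻¹) := by
    rw [inv_sub_inv hP.ne' hQ.ne', div_eq_mul_inv, mul_inv]
    ring
  have hxy : |y - x| ≤ M := abs_le.mpr ⟨by linarith, by linarith⟩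
  have hPi := inv_pos.mpr hP
  have hQi := inv_pos.mpr hQ
  rw [hd, abs_mul, abs_mul, abs_of_pos hc, abs_of_pos (mul_pos hPi hQi)]
  calc _ ≤ (1 / s * M) * (M * M) := by gcongr
    _ = M ^ 3 / s := by ring
end

section
/- Fix integers n ≥ 1, K ≥ 2, a partition of {1,…,n} into folds I_1,…,I_K with fold map k(·), an index i₀ ∈ I_1, and a real B ≥ 0. Let 𝒳 be a set, let X_i, X'_i ∈ 𝒳 for i ∈ {1,…,n} with X_j = X'_j for all j ≠ i₀, and for each a ∈ {0,1} and k ∈ {1,…,K} let μ̂_a^{(k)}, μ̂'^{(k)}_a : 𝒳 → [−B, B] with μ̂_a^{(k)} = μ̂'^{(k)}_a for all k ≠ 1. Define the aggregated outcome models μ̂_a(i) = (1/(K−1)) Σ_{k≠k(i)} μ̂_a^{(k)}(X_i), the G-Formula scores Γ_i = μ̂_1(i) − μ̂_0(i), the estimator τ̂ = (1/n)Σ_i Γ_i, and the primed analogues using X'_i and μ̂'^{(k)}_a. Then: (i) Γ_j = Γ'_j for every j ∈ I_1 with j ≠ i₀; (ii) |Γ_{i₀} − Γ'_{i₀}| ≤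 4B; (iii) |Γ_j − Γ'_j| ≤ 4B/(K−1) for every j ∉ I_1; and consequently |τ̂ − τ̂'| ≤ 4B·(1/n + 1/(K−1)). -/
open Finset

/-- G-Formula sensitivity lemma (Lemma D.1, arithmetic-mean aggregation case). -/
theorem stmt_6 {𝒳 : Type*} (n K : ℕ) (hn : 1 ≤ n) (hK : 2 ≤ K)
    (fold : Fin n → Fin K) (i₀ : Fin n) (B : ℝ) (hB : 0 ≤ B)
    (X X' : Fin n → 𝒳) (hX : ∀ j, j ≠ i₀ → X j = X' j)
    (μ0 μ1 μ0' μ1' : Fin K → 𝒳 → ℝ)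
    (hb0 : ∀ k x, |μ0 k x| ≤ B) (hb1 : ∀ k x, |μ1 k x| ≤ B)
    (hb0' : ∀ k x, |μ0' k x| ≤ B) (hb1' : ∀ k x, |μ1' k x| ≤ B)
    (hag0 : ∀ k, k ≠ fold i₀ → μ0 k = μ0' k)
    (hag1 : ∀ k, k ≠ fold i₀ → μ1 k = μ1' k)
    (Γ Γ' : Fin n → ℝ)
    (hΓ : ∀ i, Γ i =
      (1 / ((K : ℝ) - 1)) * ∑ k ∈ univ.erase (fold i), μ1 k (X i)
        - (1 / ((K : ℝ) - 1)) * ∑ k ∈ univ.erase (fold i), μ0 k (X i))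
    (hΓ' : ∀ i, Γ' i =
      (1 / ((K : ℝ) - 1)) * ∑ k ∈ univ.erase (fold i), μ1' k (X' i)
        - (1 / ((K : ℝ) - 1)) * ∑ k ∈ univ.erase (fold i), μ0' k (X' i)) :
    (∀ j, fold j = fold i₀ → j ≠ i₀ → Γ j = Γ' j) ∧
    |Γ i₀ - Γ' i₀| ≤ 4 * B ∧
    (∀ j, fold j ≠ fold i₀ → |Γ j - Γ' j| ≤ 4 * B / ((K : ℝ) - 1)) ∧
    |(1 / (n : ℝ)) * ∑ i, Γ i - (1 / (n : ℝ)) * ∑ i, Γ' i|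
      ≤ 4 * B * (1 / (n : ℝ) + 1 / ((K : ℝ) - 1)) := by
  have hK1 : (0 : ℝ) < (K : ℝ) - 1 := by
    have : (2 : ℝ) ≤ K := by exact_mod_cast hK
    linarith
  have hn0 : (0 : ℝ) < (n : ℝ) := by exact_mod_cast hn
  have hd : ∀ i, Γ i - Γ' i = (1 / ((K : ℝ) - 1)) * ∑ k ∈ univ.erase (fold i),
      (μ1 k (X i) - μ0 k (X i) - (μ1' k (X' i) - μ0' k (X' i))) := by
    intro i
    rw [hΓ, hΓ']
    simp only [Finset.sum_sub_distrib]
    ring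
  have hbd : ∀ k i, |μ1 k (X i) - μ0 k (X i) - (μ1' k (X' i) - μ0' k (X' i))| ≤ 4 * B := by
    intro k i
    have h1 := abs_le.1 (hb1 k (X i))
    have h2 := abs_le.1 (hb0 k (X i))
    have h3 := abs_le.1 (hb1' k (X' i))
    have h4 := abs_le.1 (hb0' k (X' i))
    rw [abs_le]
    constructor <;> linarith [h1.1, h1.2, h2.1, h2.2, h3.1, h3.2, h4.1, h4.2]
  have H1 : ∀ j, fold j = fold i₀ → j ≠ i₀ → Γ j = Γ' j := by
    intro j hj hne
    rw [← sub_eq_zero, hd, Finset.sum_eq_zero, mul_zero]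
    intro k hk
    have hk' : k ≠ fold i₀ := hj ▸ Finset.ne_of_mem_erase hk
    rw [hX j hne, hag0 k hk', hag1 k hk', sub_self]
  have H2 : |Γ i₀ - Γ' i₀| ≤ 4 * B := by
    rw [hd, abs_mul, abs_of_pos (by positivity : 0 < 1 / ((K : ℝ) - 1)), one_div,
      inv_mul_le_iff₀ hK1]
    refine (Finset.abs_sum_le_sum_abs _ _).trans ?_
    refine (Finset.sum_le_card_nsmul _ _ (4 * B) (fun k _ => hbd k i₀)).trans ?_
    rw [Finset.card_erase_of_mem (Finset.mem_univ _), Finset.card_univ, Fintype.card_fin,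
      nsmul_eq_mul, Nat.cast_sub (by omega), Nat.cast_one]
  have H3 : ∀ j, fold j ≠ fold i₀ → |Γ j - Γ' j| ≤ 4 * B / ((K : ℝ) - 1) := by
    intro j hj
    have hne : j ≠ i₀ := fun h => hj (by rw [h])
    rw [hd, Finset.sum_eq_single (fold i₀), abs_mul,
      abs_of_pos (by positivity : 0 < 1 / ((K : ℝ) - 1)), one_div, inv_mul_eq_div]
    · gcongr
      exact hbd _ _
    · intro k _ hk'
      rw [hX j hne, hag0 k hk', hag1 k hk', sub_self]
    · intro h
      exact absurd (Finset.mem_erase.2 ⟨hj.symm, Finset.mem_univ _⟩) h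
  refine ⟨H1, H2, H3, ?_⟩
  have hnn : 0 ≤ 4 * B / ((K : ℝ) - 1) := by positivity
  have hall : ∀ j, |Γ j - Γ' j| ≤ (if j = i₀ then 4 * B else 0) + 4 * B / ((K : ℝ) - 1) := by
    intro j
    by_cases h : j = i₀
    · subst h
      simp only [if_true]
      linarith
    · rw [if_neg h, zero_add]
      by_cases h' : fold j = fold i₀
      · rw [H1 j h' h, sub_self, abs_zero]
        exact hnn
      · exact H3 j h'
  rw [← mul_sub, ← Finset.sum_sub_distrib, abs_mul,
    abs_of_pos (by positivity : 0 < 1 / (n : ℝ)), one_div, inv_mul_le_iff₀ hn0]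
  refine (Finset.abs_sum_le_sum_abs _ _).trans ?_
  refine (Finset.sum_le_sum (fun j _ => hall j)).trans ?_
  rw [Finset.sum_add_distrib, Finset.sum_ite_eq' univ i₀, if_pos (Finset.mem_univ _),
    Finset.sum_const, Finset.card_univ, Fintype.card_fin, nsmul_eq_mul]
  apply le_of_eq
  field_simp
end

section
/- Fix integers n ≥ 1, K ≥ 2, a partition of {1,…,n} into folds I_1,…,I_K with fold map k(·), an index i₀ ∈ I_1, and a real B ≥ 0. Let ℓ : {1,…,n} → {1,…,K} satisfy ℓ(i) ≠ k(i) for all i, and set J_k = {i : ℓ(i) = k}. Let 𝒳 be a set, let X_i, X'_i ∈ 𝒳 with X_j = X'_j for all j ≠ i₀, and for each a ∈ {0,1}, k ∈ {1,…,K} let μ̂_a^{(k)}, μ̂'^{(k)}_a : 𝒳 → [−B, B] with μ̂_a^{(k)} = μ̂'^{(k)}_a for all k ≠ 1. Define the sampled scores Γ_i = μ̂_1^{(ℓ(i))}(X_i) − μ̂_0^{(ℓ(i))}(X_i), the estimator τ̂ = (1/n)Σ_i Γ_i, and the primed analogues. Then: (i) Γ_j = Γ'_j for every j ∈ I_1 with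 j ≠ i₀; (ii) |Γ_{i₀} − Γ'_{i₀}| ≤ 4B; (iii) |Γ_j − Γ'_j| ≤ 4B·1{j ∈ J_1} for every j ∉ I_1; and consequently |τ̂ − τ̂'| ≤ 4B/n + 4B·(max_{k} |J_k|)/n. -/
open Finset

/-- G-Formula sensitivity lemma, sampling-aggregation case (Lemma D.1 with Φ_μ = Φ_ℓ). -/
theorem stmt_7 {𝒳 : Type*} (n K : ℕ) (hn : 1 ≤ n) (hK : 2 ≤ K)
    (fold : Fin n → Fin K) (i₀ : Fin n) (B : ℝ) (hB : 0 ≤ B)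
    (ℓ : Fin n → Fin K) (hℓ : ∀ i, ℓ i ≠ fold i)
    (X X' : Fin n → 𝒳) (hX : ∀ j, j ≠ i₀ → X j = X' j)
    (μ0 μ1 μ0' μ1' : Fin K → 𝒳 → ℝ)
    (hb0 : ∀ k x, |μ0 k x| ≤ B) (hb1 : ∀ k x, |μ1 k x| ≤ B)
    (hb0' : ∀ k x, |μ0' k x| ≤ B) (hb1' : ∀ k x, |μ1' k x| ≤ B)
    (hag0 : ∀ k, k ≠ fold i₀ → μ0 k = μ0' k)
    (hag1 : ∀ k, k ≠ fold i₀ → μ1 k = μ1' k)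
    (Γ Γ' : Fin n → ℝ)
    (hΓ : ∀ i, Γ i = μ1 (ℓ i) (X i) - μ0 (ℓ i) (X i))
    (hΓ' : ∀ i, Γ' i = μ1' (ℓ i) (X' i) - μ0' (ℓ i) (X' i)) :
    (∀ j, fold j = fold i₀ → j ≠ i₀ → Γ j = Γ' j) ∧
    |Γ i₀ - Γ' i₀| ≤ 4 * B ∧
    (∀ j, fold j ≠ fold i₀ →
      |Γ j - Γ' j| ≤ 4 * B * (if ℓ j = fold i₀ then 1 else 0)) ∧
    |(1 / (n : ℝ)) * ∑ i, Γ i - (1 / (n : ℝ)) * ∑ i, Γ' i|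
      ≤ 4 * B / (n : ℝ)
        + 4 * B * ((univ.sup fun k : Fin K =>
            (univ.filter fun i : Fin n => ℓ i = k).card : ℕ) : ℝ) / (n : ℝ) := by
  have hall : ∀ j, |Γ j - Γ' j| ≤ 4 * B := by
    intro j
    rw [hΓ, hΓ']
    have h1 := abs_le.mp (hb0 (ℓ j) (X j))
    have h2 := abs_le.mp (hb1 (ℓ j) (X j))
    have h3 := abs_le.mp (hb0' (ℓ j) (X' j))
    have h4 := abs_le.mp (hb1' (ℓ j) (X' j))
    rw [abs_le]
    constructor <;> linarith [h1.1, h1.2, h2.1, h2.2, h3.1, h3.2, h4.1, h4.2]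
  have heq : ∀ j, j ≠ i₀ → ℓ j ≠ fold i₀ → Γ j = Γ' j := by
    intro j hj hl
    rw [hΓ, hΓ', hag0 _ hl, hag1 _ hl, hX j hj]
  refine ⟨fun j hf hj => heq j hj (hf ▸ hℓ j), hall i₀, ?_, ?_⟩
  · intro j hf
    have hj : j ≠ i₀ := fun h => hf (by rw [h])
    by_cases hl : ℓ j = fold i₀
    · simpa [hl] using hall j
    · simp [hl, heq j hj hl]
  · have hpt : ∀ j, |Γ j - Γ' j| ≤
        4 * B * (if j = i₀ then 1 else 0) + 4 * B * (if ℓ j = fold i₀ then 1 else 0) := by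
      intro j
      have := hall j
      by_cases hj : j = i₀
      · by_cases hl : ℓ j = fold i₀
        · rw [if_pos hj, if_pos hl]; linarith
        · rw [if_pos hj, if_neg hl]; linarith
      · by_cases hl : ℓ j = fold i₀
        · rw [if_neg hj, if_pos hl]; linarith
        · rw [if_neg hj, if_neg hl, heq j hj hl]; simp
    have hn' : (0 : ℝ) < n := by exact_mod_cast hn
    have hcard : (((univ.filter fun i : Fin n => ℓ i = fold i₀).card : ℕ) : ℝ) ≤
        ((univ.sup fun k : Fin K => (univ.filter fun i : Fin n => ℓ i = k).card : ℕ) : ℝ) := by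
      exact_mod_cast Finset.le_sup (f := fun k : Fin K =>
        (univ.filter fun i : Fin n => ℓ i = k).card) (mem_univ (fold i₀))
    have hsum : |∑ i, (Γ i - Γ' i)| ≤ 4 * B +
        4 * B * (((univ.filter fun i : Fin n => ℓ i = fold i₀).card : ℕ) : ℝ) := by
      refine (abs_sum_le_sum_abs _ _).trans ((sum_le_sum fun j _ => hpt j).trans (le_of_eq ?_))
      rw [sum_add_distrib, ← mul_sum, ← mul_sum, sum_boole, sum_boole]
      simp [filter_eq']
    rw [← mul_sub, ← sum_sub_distrib, abs_mul, abs_of_pos (by positivity), ← add_div,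
      one_div_mul_eq_div]
    gcongr
    refine hsum.trans ?_
    gcongr
end

section
/- Fix integers n ≥ 1, K ≥ 2, a partition of {1,…,n} into folds I_1,…,I_K with fold map k(·), an index i₀ ∈ I_1, and reals B_μ ≥ 0, B_π ≥ 1. Let 𝒳 be a set, and let (X_i, A_i, Y_i), (X'_i, A'_i, Y'_i) ∈ 𝒳 × {0,1} × [−B_μ, B_μ] for i ∈ {1,…,n} agree for all i ≠ i₀. For each k ∈ {1,…,K} let π̂^{(k)}, π̂'^{(k)} : 𝒳 → (0,1) satisfy 1/π̂^{(k)}(x) ≤ B_π and 1/(1 − π̂^{(k)}(x)) ≤ B_π for all x (and likewise for π̂'^{(k)}), with π̂^{(k)} = π̂'^{(k)} for all k ≠ 1. Define the IPW scores with harmonic-mean propensity aggregation Γ_i = A_i Y_i · (1/(K−1)) Σ_{k≠k(i)} 1/π̂^{(k)}(X_i) − (1−A_i) Y_i · (1/(K−1)) Σ_{k≠k(i)} 1/(1−π̂^{(k)}(X_i)), the estimator τ̂ = (1/n)Σ_i Γ_i, and the primed analogues. Then: (i) Γ_j = Γ'_j for every j ∈ I_1 with j ≠ i₀; (ii) |Γ_{i₀}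 − Γ'_{i₀}| ≤ 2B_μB_π; (iii) |Γ_j − Γ'_j| ≤ B_μB_π/(K−1) for every j ∉ I_1; and consequently |τ̂ − τ̂'| ≤ 2B_μB_π/n + B_μB_π/(K−1). -/
open Finset

lemma aux_avg {K : ℕ} (hK : 2 ≤ K) (a : Fin K) (f : Fin K → ℝ) (B : ℝ)
    (h0 : ∀ k, 0 ≤ f k) (hB : ∀ k, f k ≤ B) :
    |(1 / ((K : ℝ) - 1)) * ∑ k ∈ univ.erase a, f k| ≤ B := by
  have hK' : (2 : ℝ) ≤ K := by exact_mod_cast hK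
  have hpos : (0 : ℝ) < (K : ℝ) - 1 := by linarith
  have hs0 : 0 ≤ ∑ k ∈ univ.erase a, f k := Finset.sum_nonneg (fun k _ => h0 k)
  have hs : ∑ k ∈ univ.erase a, f k ≤ ((K : ℝ) - 1) * B := by
    have := Finset.sum_le_card_nsmul (univ.erase a) f B (fun k _ => hB k)
    rw [Finset.card_erase_of_mem (Finset.mem_univ a), Finset.card_univ, Fintype.card_fin,
      nsmul_eq_mul, Nat.cast_sub (by omega)] at this
    simpa using this
  rw [abs_of_nonneg (by positivity), one_div, inv_mul_le_iff₀ hpos]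
  exact hs

lemma aux_diff {K : ℕ} (hK : 2 ≤ K) (a c : Fin K) (hac : a ≠ c) (f g : Fin K → ℝ) (B : ℝ)
    (h0 : ∀ k, 0 ≤ f k) (hB : ∀ k, f k ≤ B) (h0' : ∀ k, 0 ≤ g k) (hB' : ∀ k, g k ≤ B)
    (hag : ∀ k, k ≠ c → f k = g k) :
    |(1 / ((K : ℝ) - 1)) * ∑ k ∈ univ.erase a, f k
      - (1 / ((K : ℝ) - 1)) * ∑ k ∈ univ.erase a, g k| ≤ B / ((K : ℝ) - 1) := by
  have hK' : (2 : ℝ) ≤ K := by exact_mod_cast hK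
  have hpos : (0 : ℝ) < (K : ℝ) - 1 := by linarith
  have e : ∑ k ∈ univ.erase a, (f k - g k) = f c - g c := by
    apply Finset.sum_eq_single c
    · intro k _ hk
      rw [hag k hk, sub_self]
    · intro h
      exact absurd (Finset.mem_erase.2 ⟨hac.symm, Finset.mem_univ c⟩) h
  rw [← mul_sub, ← Finset.sum_sub_distrib, e, abs_mul, abs_of_pos (by positivity), one_div,
    div_eq_inv_mul]
  apply mul_le_mul_of_nonneg_left _ (by positivity)
  rw [abs_le]
  constructor <;> linarith [h0 c, hB c, h0' c, hB' c]

lemma aux_score (A Y p q M B : ℝ) (hA : A = 0 ∨ A = 1) (hM : 0 ≤ M) (hY : |Y| ≤ M)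
    (hp : |p| ≤ B) (hq : |q| ≤ B) : |A * Y * p - (1 - A) * Y * q| ≤ M * B := by
  rcases hA with rfl | rfl
  · have := mul_le_mul hY hq (abs_nonneg _) hM
    simpa [abs_mul] using this
  · have := mul_le_mul hY hp (abs_nonneg _) hM
    simpa [abs_mul] using this


/-- IPW sensitivity lemma (Lemma E.1, harmonic-mean aggregation case). -/
theorem stmt_8 {𝒳 : Type*} (n K : ℕ) (hn : 1 ≤ n) (hK : 2 ≤ K)
    (fold : Fin n → Fin K) (i₀ : Fin n) (Bμ Bπ : ℝ) (hBμ : 0 ≤ Bμ) (hBπ : 1 ≤ Bπ)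
    (X X' : Fin n → 𝒳) (A A' Y Y' : Fin n → ℝ)
    (hA : ∀ i, A i = 0 ∨ A i = 1) (hA' : ∀ i, A' i = 0 ∨ A' i = 1)
    (hY : ∀ i, |Y i| ≤ Bμ) (hY' : ∀ i, |Y' i| ≤ Bμ)
    (hXag : ∀ i, i ≠ i₀ → X i = X' i)
    (hAag : ∀ i, i ≠ i₀ → A i = A' i)
    (hYag : ∀ i, i ≠ i₀ → Y i = Y' i)
    (π π' : Fin K → 𝒳 → ℝ)
    (hπ01 : ∀ k x, 0 < π k x ∧ π k x < 1) (hπ01' : ∀ k x, 0 < π' k x ∧ π' k x < 1)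
    (hπB : ∀ k x, 1 / π k x ≤ Bπ ∧ 1 / (1 - π k x) ≤ Bπ)
    (hπB' : ∀ k x, 1 / π' k x ≤ Bπ ∧ 1 / (1 - π' k x) ≤ Bπ)
    (hπag : ∀ k, k ≠ fold i₀ → π k = π' k)
    (Γ Γ' : Fin n → ℝ)
    (hΓ : ∀ i, Γ i =
      A i * Y i * ((1 / ((K : ℝ) - 1)) * ∑ k ∈ univ.erase (fold i), 1 / π k (X i))
        - (1 - A i) * Y i *
            ((1 / ((K : ℝ) - 1)) * ∑ k ∈ univ.erase (fold i), 1 / (1 - π k (X i))))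
    (hΓ' : ∀ i, Γ' i =
      A' i * Y' i * ((1 / ((K : ℝ) - 1)) * ∑ k ∈ univ.erase (fold i), 1 / π' k (X' i))
        - (1 - A' i) * Y' i *
            ((1 / ((K : ℝ) - 1)) * ∑ k ∈ univ.erase (fold i), 1 / (1 - π' k (X' i)))) :
    (∀ j, fold j = fold i₀ → j ≠ i₀ → Γ j = Γ' j) ∧
    |Γ i₀ - Γ' i₀| ≤ 2 * Bμ * Bπ ∧
    (∀ j, fold j ≠ fold i₀ → |Γ j - Γ' j| ≤ Bμ * Bπ / ((K : ℝ) - 1)) ∧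
    |(1 / (n : ℝ)) * ∑ i, Γ i - (1 / (n : ℝ)) * ∑ i, Γ' i|
      ≤ 2 * Bμ * Bπ / (n : ℝ) + Bμ * Bπ / ((K : ℝ) - 1) := by
  have hK' : (2 : ℝ) ≤ K := by exact_mod_cast hK
  have hpos : (0 : ℝ) < (K : ℝ) - 1 := by linarith
  have hn' : (0 : ℝ) < n := by exact_mod_cast hn
  have p0 : ∀ k x, 0 ≤ 1 / π k x := fun k x => one_div_nonneg.2 (hπ01 k x).1.le
  have q0 : ∀ k x, 0 ≤ 1 / (1 - π k x) := fun k x =>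
    one_div_nonneg.2 (sub_nonneg.2 (hπ01 k x).2.le)
  have p0' : ∀ k x, 0 ≤ 1 / π' k x := fun k x => one_div_nonneg.2 (hπ01' k x).1.le
  have q0' : ∀ k x, 0 ≤ 1 / (1 - π' k x) := fun k x =>
    one_div_nonneg.2 (sub_nonneg.2 (hπ01' k x).2.le)
  have h1 : ∀ j, fold j = fold i₀ → j ≠ i₀ → Γ j = Γ' j := by
    intro j hj hne
    have e1 : ∑ k ∈ univ.erase (fold j), 1 / π k (X j)
        = ∑ k ∈ univ.erase (fold j), 1 / π' k (X' j) := by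
      apply Finset.sum_congr rfl
      intro k hk
      rw [hπag k (hj ▸ (Finset.mem_erase.1 hk).1), hXag j hne]
    have e2 : ∑ k ∈ univ.erase (fold j), 1 / (1 - π k (X j))
        = ∑ k ∈ univ.erase (fold j), 1 / (1 - π' k (X' j)) := by
      apply Finset.sum_congr rfl
      intro k hk
      rw [hπag k (hj ▸ (Finset.mem_erase.1 hk).1), hXag j hne]
    rw [hΓ, hΓ', e1, e2, hAag j hne, hYag j hne]
  have h2 : |Γ i₀ - Γ' i₀| ≤ 2 * Bμ * Bπ := by
    have a1 : |Γ i₀| ≤ Bμ * Bπ := by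
      rw [hΓ]
      exact aux_score _ _ _ _ _ _ (hA i₀) hBμ (hY i₀)
        (aux_avg hK _ _ _ (fun k => p0 k _) (fun k => (hπB k _).1))
        (aux_avg hK _ _ _ (fun k => q0 k _) (fun k => (hπB k _).2))
    have a2 : |Γ' i₀| ≤ Bμ * Bπ := by
      rw [hΓ']
      exact aux_score _ _ _ _ _ _ (hA' i₀) hBμ (hY' i₀)
        (aux_avg hK _ _ _ (fun k => p0' k _) (fun k => (hπB' k _).1))
        (aux_avg hK _ _ _ (fun k => q0' k _) (fun k => (hπB' k _).2))
    have := abs_sub (Γ i₀) (Γ' i₀)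
    linarith
  have h3 : ∀ j, fold j ≠ fold i₀ → |Γ j - Γ' j| ≤ Bμ * Bπ / ((K : ℝ) - 1) := by
    intro j hj
    have hne : j ≠ i₀ := fun h => hj (by rw [h])
    rw [hΓ, hΓ', ← hAag j hne, ← hYag j hne, ← hXag j hne, mul_div_assoc]
    have := aux_score _ _ _ _ _ _ (hA j) hBμ (hY j)
      (aux_diff hK (fold j) (fold i₀) hj (fun k => 1 / π k (X j)) (fun k => 1 / π' k (X j)) Bπ
        (fun k => p0 k _) (fun k => (hπB k _).1) (fun k => p0' k _) (fun k => (hπB' k _).1)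
        (fun k hk => by simp only [hπag k hk]))
      (aux_diff hK (fold j) (fold i₀) hj (fun k => 1 / (1 - π k (X j)))
        (fun k => 1 / (1 - π' k (X j))) Bπ
        (fun k => q0 k _) (fun k => (hπB k _).2) (fun k => q0' k _) (fun k => (hπB' k _).2)
        (fun k hk => by simp only [hπag k hk]))
    refine le_trans (le_of_eq ?_) this
    congr 1
    ring
  refine ⟨h1, h2, h3, ?_⟩
  have hD : 0 ≤ Bμ * Bπ / ((K : ℝ) - 1) := by
    have : 0 ≤ Bπ := by linarith
    positivity
  have hall : ∀ j, |Γ j - Γ' j|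
      ≤ (if j = i₀ then 2 * Bμ * Bπ else 0) + Bμ * Bπ / ((K : ℝ) - 1) := by
    intro j
    by_cases hj : j = i₀
    · subst hj
      simp only [if_true]
      linarith
    · rw [if_neg hj, zero_add]
      by_cases hf : fold j = fold i₀
      · rw [h1 j hf hj, sub_self, abs_zero]
        exact hD
      · exact h3 j hf
  rw [← mul_sub, ← Finset.sum_sub_distrib, abs_mul, abs_of_pos (by positivity)]
  have hsum : |∑ i, (Γ i - Γ' i)| ≤ 2 * Bμ * Bπ + n * (Bμ * Bπ / ((K : ℝ) - 1)) := by
    refine (Finset.abs_sum_le_sum_abs _ _).trans ((Finset.sum_le_sum (fun j _ => hall j)).trans ?_)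
    rw [Finset.sum_add_distrib]
    simp
  calc _ ≤ 1 / (n : ℝ) * (2 * Bμ * Bπ + n * (Bμ * Bπ / ((K : ℝ) - 1))) :=
        mul_le_mul_of_nonneg_left hsum (by positivity)
    _ = _ := by
        rw [mul_add, ← mul_assoc (1 / (n : ℝ)) (n : ℝ), one_div_mul_cancel hn'.ne']
        ring
end

section
/- Fix integers n ≥ 1, K ≥ 2, a partition of {1,…,n} into folds I_1,…,I_K with fold map k(·), an index i₀ ∈ I_1, and reals B_μ ≥ 0, B_π ≥ 1. Let ℓ : {1,…,n} → {1,…,K} satisfy ℓ(i) ≠ k(i) for all i, with J_k = {i : ℓ(i) = k}. Let (X_i, A_i, Y_i), (X'_i, A'_i, Y'_i) ∈ 𝒳 × {0,1} × [−B_μ, B_μ] agree for all i ≠ i₀, and for each k let π̂^{(k)}, π̂'^{(k)} : 𝒳 → (0,1) satisfy 1/π̂^{(k)}(x) ≤ B_π and 1/(1 − π̂^{(k)}(x)) ≤ B_π for all x (likewise primed), with π̂^{(k)} = π̂'^{(k)} for all k ≠ 1. Define the sampled IPW scores Γ_i = A_i Y_i / π̂^{(ℓ(i))}(X_i) − (1−A_i)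 Y_i / (1 − π̂^{(ℓ(i))}(X_i)), τ̂ = (1/n)Σ_i Γ_i, and primed analogues. Then: (i) Γ_j = Γ'_j for every j ∈ I_1 with j ≠ i₀; (ii) |Γ_{i₀} − Γ'_{i₀}| ≤ 2B_μB_π; (iii) |Γ_j − Γ'_j| ≤ B_μB_π·1{j ∈ J_1} for every j ∉ I_1; and consequently |τ̂ − τ̂'| ≤ 2B_μB_π/n + B_μB_π·(max_k |J_k|)/n. -/
open Finset

lemma aux_abs (a y p B C : ℝ) (ha : a = 0 ∨ a = 1) (hy : |y| ≤ B) (hB : 0 ≤ B)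
    (hp : 0 < p ∧ p < 1) (hC : 1 / p ≤ C ∧ 1 / (1 - p) ≤ C) :
    |a * y / p - (1 - a) * y / (1 - p)| ≤ B * C := by
  have h1 : 0 < 1 - p := by linarith [hp.2]
  rcases ha with rfl | rfl
  · have e : (0 : ℝ) * y / p - (1 - 0) * y / (1 - p) = -(y * (1 / (1 - p))) := by ring
    rw [e, abs_neg, abs_mul, abs_of_pos (one_div_pos.mpr h1)]
    exact mul_le_mul hy hC.2 (one_div_pos.mpr h1).le hB
  · have e : (1 : ℝ) * y / p - (1 - 1) * y / (1 - p) = y * (1 / p) := by ring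
    rw [e, abs_mul, abs_of_pos (one_div_pos.mpr hp.1)]
    exact mul_le_mul hy hC.1 (one_div_pos.mpr hp.1).le hB

lemma aux_diff_s9 (a y p q B C : ℝ) (ha : a = 0 ∨ a = 1) (hy : |y| ≤ B) (hB : 0 ≤ B)
    (hp : 0 < p ∧ p < 1) (hC : 1 / p ≤ C ∧ 1 / (1 - p) ≤ C)
    (hq : 0 < q ∧ q < 1) (hD : 1 / q ≤ C ∧ 1 / (1 - q) ≤ C) :
    |(a * y / p - (1 - a) * y / (1 - p)) - (a * y / q - (1 - a) * y / (1 - q))| ≤ B * C := by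
  have h1 : 0 < 1 / (1 - p) := one_div_pos.mpr (by linarith [hp.2])
  have h2 : 0 < 1 / (1 - q) := one_div_pos.mpr (by linarith [hq.2])
  have h3 : 0 < 1 / p := one_div_pos.mpr hp.1
  have h4 : 0 < 1 / q := one_div_pos.mpr hq.1
  rcases ha with rfl | rfl
  · have e : ((0 : ℝ) * y / p - (1 - 0) * y / (1 - p)) - (0 * y / q - (1 - 0) * y / (1 - q))
        = y * (1 / (1 - q) - 1 / (1 - p)) := by ring
    rw [e, abs_mul]
    refine mul_le_mul hy ?_ (abs_nonneg _) hB
    rw [abs_le]; constructor <;> linarith [hC.2, hD.2]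
  · have e : ((1 : ℝ) * y / p - (1 - 1) * y / (1 - p)) - (1 * y / q - (1 - 1) * y / (1 - q))
        = y * (1 / p - 1 / q) := by ring
    rw [e, abs_mul]
    refine mul_le_mul hy ?_ (abs_nonneg _) hB
    rw [abs_le]; constructor <;> linarith [hC.1, hD.1]

/-- IPW sensitivity lemma, sampling-aggregation case (Lemma E.1 with Φ_π = Φ_{1−π} = Φ_ℓ). -/
theorem stmt_9 {𝒳 : Type*} (n K : ℕ) (hn : 1 ≤ n) (hK : 2 ≤ K)
    (fold : Fin n → Fin K) (i₀ : Fin n) (Bμ Bπ : ℝ) (hBμ : 0 ≤ Bμ) (hBπ : 1 ≤ Bπ)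
    (ℓ : Fin n → Fin K) (hℓ : ∀ i, ℓ i ≠ fold i)
    (X X' : Fin n → 𝒳) (A A' Y Y' : Fin n → ℝ)
    (hA : ∀ i, A i = 0 ∨ A i = 1) (hA' : ∀ i, A' i = 0 ∨ A' i = 1)
    (hY : ∀ i, |Y i| ≤ Bμ) (hY' : ∀ i, |Y' i| ≤ Bμ)
    (hXag : ∀ i, i ≠ i₀ → X i = X' i)
    (hAag : ∀ i, i ≠ i₀ → A i = A' i)
    (hYag : ∀ i, i ≠ i₀ → Y i = Y' i)
    (π π' : Fin K → 𝒳 → ℝ)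
    (hπ01 : ∀ k x, 0 < π k x ∧ π k x < 1) (hπ01' : ∀ k x, 0 < π' k x ∧ π' k x < 1)
    (hπB : ∀ k x, 1 / π k x ≤ Bπ ∧ 1 / (1 - π k x) ≤ Bπ)
    (hπB' : ∀ k x, 1 / π' k x ≤ Bπ ∧ 1 / (1 - π' k x) ≤ Bπ)
    (hπag : ∀ k, k ≠ fold i₀ → π k = π' k)
    (Γ Γ' : Fin n → ℝ)
    (hΓ : ∀ i, Γ i =
      A i * Y i / π (ℓ i) (X i) - (1 - A i) * Y i / (1 - π (ℓ i) (X i)))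
    (hΓ' : ∀ i, Γ' i =
      A' i * Y' i / π' (ℓ i) (X' i) - (1 - A' i) * Y' i / (1 - π' (ℓ i) (X' i))) :
    (∀ j, fold j = fold i₀ → j ≠ i₀ → Γ j = Γ' j) ∧
    |Γ i₀ - Γ' i₀| ≤ 2 * Bμ * Bπ ∧
    (∀ j, fold j ≠ fold i₀ →
      |Γ j - Γ' j| ≤ Bμ * Bπ * (if ℓ j = fold i₀ then 1 else 0)) ∧
    |(1 / (n : ℝ)) * ∑ i, Γ i - (1 / (n : ℝ)) * ∑ i, Γ' i|
      ≤ 2 * Bμ * Bπ / (n : ℝ)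
        + Bμ * Bπ * ((univ.sup fun k : Fin K =>
            (univ.filter fun i : Fin n => ℓ i = k).card : ℕ) : ℝ) / (n : ℝ) := by
  have hBB : 0 ≤ Bμ * Bπ := mul_nonneg hBμ (by linarith)
  have c0 : ∀ j, j ≠ i₀ → ℓ j ≠ fold i₀ → Γ j = Γ' j := by
    intro j hj hl
    rw [hΓ, hΓ', hXag j hj, hAag j hj, hYag j hj, hπag _ hl]
  have c1 : ∀ j, fold j = fold i₀ → j ≠ i₀ → Γ j = Γ' j := by
    intro j hf hj
    exact c0 j hj (hf ▸ hℓ j)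
  have c2 : |Γ i₀ - Γ' i₀| ≤ 2 * Bμ * Bπ := by
    have h1 := aux_abs _ _ _ _ _ (hA i₀) (hY i₀) hBμ (hπ01 (ℓ i₀) (X i₀)) (hπB (ℓ i₀) (X i₀))
    have h2 := aux_abs _ _ _ _ _ (hA' i₀) (hY' i₀) hBμ (hπ01' (ℓ i₀) (X' i₀))
      (hπB' (ℓ i₀) (X' i₀))
    rw [← hΓ] at h1
    rw [← hΓ'] at h2
    have := abs_sub (Γ i₀) (Γ' i₀)
    linarith
  have c3 : ∀ j, j ≠ i₀ →
      |Γ j - Γ' j| ≤ Bμ * Bπ * (if ℓ j = fold i₀ then 1 else 0) := by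
    intro j hj
    split_ifs with h
    · rw [mul_one, hΓ, hΓ', hXag j hj, hAag j hj, hYag j hj]
      exact aux_diff_s9 _ _ _ _ _ _ (hA' j) (hY' j) hBμ (hπ01 _ _) (hπB _ _) (hπ01' _ _) (hπB' _ _)
    · rw [c0 j hj h]; simp
  refine ⟨c1, c2, fun j hf => c3 j (fun h => hf (h ▸ rfl)), ?_⟩
  have key : ∀ i, |Γ i - Γ' i| ≤ (if i = i₀ then 2 * Bμ * Bπ else 0)
      + Bμ * Bπ * (if ℓ i = fold i₀ then 1 else 0) := by
    intro i
    by_cases h : i = i₀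
    · subst h
      rw [if_pos rfl, if_neg (hℓ i)]
      linarith
    · rw [if_neg h, zero_add]
      exact c3 i h
  have hs : |∑ i, (Γ i - Γ' i)| ≤ 2 * Bμ * Bπ
      + Bμ * Bπ * ((univ.filter fun i : Fin n => ℓ i = fold i₀).card : ℝ) := by
    refine (abs_sum_le_sum_abs _ _).trans ((sum_le_sum fun i _ => key i).trans (le_of_eq ?_))
    rw [sum_add_distrib, ← mul_sum]
    simp
  have hm : ((univ.filter fun i : Fin n => ℓ i = fold i₀).card : ℝ) ≤
      ((univ.sup fun k : Fin K => (univ.filter fun i : Fin n => ℓ i = k).card : ℕ) : ℝ) :=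
    Nat.cast_le.mpr (le_sup (f := fun k : Fin K => (univ.filter fun i : Fin n => ℓ i = k).card)
      (mem_univ (fold i₀)))
  have hn0 : (0 : ℝ) < n := by exact_mod_cast hn
  rw [← mul_sub, ← sum_sub_distrib, abs_mul, abs_of_pos (one_div_pos.mpr hn0), ← add_div,
    one_div, inv_mul_eq_div]
  have := mul_le_mul_of_nonneg_left hm hBB
  exact div_le_div_of_nonneg_right (by linarith) hn0.le
end

section
/- Fix integers n ≥ 1, K ≥ 2, a partition of {1,…,n} into folds I_1,…,I_K with fold map k(·), an index i₀ ∈ I_1, and reals B_μ ≥ 0, B_π ≥ 1. Let (X_i, A_i, Y_i), (X'_i, A'_i, Y'_i) ∈ 𝒳 × {0,1} × [−B_μ, B_μ] agree for all i ≠ i₀. For each k and a ∈ {0,1} let μ̂_a^{(k)}, μ̂'^{(k)}_a : 𝒳 → [−B_μ, B_μ] and π̂^{(k)}, π̂'^{(k)} : 𝒳 → (0,1) with 1/π̂^{(k)}(x) ≤ B_π and 1/(1−π̂^{(k)}(x)) ≤ B_π for all x (likewise primed), and with all fold-k models equal to their primed versions for k ≠ 1. Define μ̂_a(i) = (1/(K−1))Σ_{k≠k(i)}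 μ̂_a^{(k)}(X_i), W_1(i) = (1/(K−1))Σ_{k≠k(i)} 1/π̂^{(k)}(X_i), W_0(i) = (1/(K−1))Σ_{k≠k(i)} 1/(1−π̂^{(k)}(X_i)), the AIPW scores Γ_i = μ̂_1(i) − μ̂_0(i) + A_i·(Y_i − μ̂_1(i))·W_1(i) − (1−A_i)·(Y_i − μ̂_0(i))·W_0(i), τ̂ = (1/n)Σ_i Γ_i, and primed analogues. Then: (i) Γ_j = Γ'_j for every j ∈ I_1 with j ≠ i₀; (ii) |Γ_{i₀} − Γ'_{i₀}| ≤ 4B_μ(1 + B_π); (iii) |Γ_j − Γ'_j| ≤ 4B_μ(1 + B_π)/(K−1) for every j ∉ I_1; and consequently |τ̂ − τ̂'| ≤ 4B_μ(1 + B_π)·(1/n + 1/(K−1)). -/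
open Finset

lemma avg_abs (K : ℕ) (hK : 2 ≤ K) (m : Fin K) (f : Fin K → ℝ) (B : ℝ)
    (hf : ∀ k, |f k| ≤ B) : |(1 / ((K : ℝ) - 1)) * ∑ k ∈ univ.erase m, f k| ≤ B := by
  have hK' : (2 : ℝ) ≤ K := by exact_mod_cast hK
  have h1 : (0 : ℝ) < (K : ℝ) - 1 := by linarith
  have h2 : |∑ k ∈ univ.erase m, f k| ≤ ((K : ℝ) - 1) * B := by
    refine (Finset.abs_sum_le_sum_abs _ _).trans ?_
    refine (Finset.sum_le_card_nsmul _ _ B (fun k _ => hf k)).trans ?_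
    rw [Finset.card_erase_of_mem (Finset.mem_univ m), nsmul_eq_mul, Finset.card_univ,
      Fintype.card_fin, Nat.cast_sub (by omega), Nat.cast_one]
  rw [abs_mul, abs_of_pos (by positivity : (0 : ℝ) < 1 / ((K : ℝ) - 1)), one_div_mul_eq_div,
    div_le_iff₀ h1]
  linarith

lemma avg_diff (K : ℕ) (hK : 2 ≤ K) (m p : Fin K) (f g : Fin K → ℝ) (D : ℝ) (hD : 0 ≤ D)
    (hfg : ∀ k, k ≠ p → f k = g k) (hp : |f p - g p| ≤ D) :
    |(1 / ((K : ℝ) - 1)) * ∑ k ∈ univ.erase m, f k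
      - (1 / ((K : ℝ) - 1)) * ∑ k ∈ univ.erase m, g k| ≤ D / ((K : ℝ) - 1) := by
  have hK' : (2 : ℝ) ≤ K := by exact_mod_cast hK
  have h1 : (0 : ℝ) < (K : ℝ) - 1 := by linarith
  have h2 : |∑ k ∈ univ.erase m, (f k - g k)| ≤ D := by
    refine (Finset.abs_sum_le_sum_abs _ _).trans ?_
    refine (Finset.sum_le_sum_of_subset_of_nonneg (Finset.erase_subset m univ)
      (fun _ _ _ => abs_nonneg _)).trans ?_
    rw [Finset.sum_eq_single p (fun k _ hk => by rw [hfg k hk]; simp) (by simp)]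
    exact hp
  rw [← mul_sub, ← Finset.sum_sub_distrib, abs_mul,
    abs_of_pos (by positivity : (0 : ℝ) < 1 / ((K : ℝ) - 1)), one_div_mul_eq_div]
  gcongr

lemma score_abs (B P a y m0 m1 w0 w1 : ℝ) (ha : a = 0 ∨ a = 1)
    (hy : |y| ≤ B) (h0 : |m0| ≤ B) (h1 : |m1| ≤ B) (hw0 : |w0| ≤ P) (hw1 : |w1| ≤ P) :
    |m1 - m0 + a * (y - m1) * w1 - (1 - a) * (y - m0) * w0| ≤ 2 * B * (1 + P) := by
  have key : ∀ m w : ℝ, |m| ≤ B → |w| ≤ P → |(y - m) * w| ≤ 2 * B * P := by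
    intro m w hm hw
    rw [abs_mul]
    have : |y - m| ≤ 2 * B := by
      have := abs_sub y m
      linarith
    exact mul_le_mul this hw (abs_nonneg _) ((abs_nonneg _).trans this)
  have k0 := abs_le.mp (key m0 w0 h0 hw0)
  have k1 := abs_le.mp (key m1 w1 h1 hw1)
  rw [abs_le] at h0 h1
  rcases ha with rfl | rfl <;> rw [abs_le] <;> constructor <;> nlinarith

lemma score_diff (B P d a y m0 m1 w0 w1 m0' m1' w0' w1' : ℝ) (ha : a = 0 ∨ a = 1)
    (hy : |y| ≤ B) (h0 : |m0| ≤ B) (h1 : |m1| ≤ B) (hw0 : |w0'| ≤ P) (hw1 : |w1'| ≤ P)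
    (d0 : |m0 - m0'| ≤ 2 * B * d) (d1 : |m1 - m1'| ≤ 2 * B * d)
    (e0 : |w0 - w0'| ≤ P * d) (e1 : |w1 - w1'| ≤ P * d) :
    |(m1 - m0 + a * (y - m1) * w1 - (1 - a) * (y - m0) * w0)
      - (m1' - m0' + a * (y - m1') * w1' - (1 - a) * (y - m0') * w0')|
      ≤ 4 * B * (1 + P) * d := by
  have key : ∀ m w m' w' : ℝ, |m| ≤ B → |w'| ≤ P → |m - m'| ≤ 2 * B * d → |w - w'| ≤ P * d →
      |(y - m) * (w - w') - (m - m') * w'| ≤ 4 * B * P * d := by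
    intro m w m' w' hm hw hmm hww
    have : |y - m| ≤ 2 * B := by
      have := abs_sub y m
      linarith
    have q1 := mul_le_mul this hww (abs_nonneg _) ((abs_nonneg _).trans this)
    have q2 := mul_le_mul hmm hw (abs_nonneg _) ((abs_nonneg _).trans hmm)
    have q3 := abs_sub ((y - m) * (w - w')) ((m - m') * w')
    rw [abs_mul, abs_mul] at q3
    nlinarith
  have k0 := abs_le.mp (key m0 w0 m0' w0' h0 hw0 d0 e0)
  have k1 := abs_le.mp (key m1 w1 m1' w1' h1 hw1 d1 e1)
  rw [abs_le] at d0 d1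
  rcases ha with rfl | rfl <;> rw [abs_le] <;> constructor <;> nlinarith

lemma inv_abs (P x : ℝ) (hx : 0 < x) (h : 1 / x ≤ P) : |1 / x| ≤ P := by
  rwa [abs_of_pos (by positivity)]

lemma inv_diff (P x y : ℝ) (hx : 0 < x) (h : 1 / x ≤ P) (hy : 0 < y) (h' : 1 / y ≤ P) :
    |1 / x - 1 / y| ≤ P := by
  have : 0 < 1 / x := by positivity
  have : 0 < 1 / y := by positivity
  rw [abs_le]; constructor <;> linarith

lemma bd_diff (B x y : ℝ) (h : |x| ≤ B) (h' : |y| ≤ B) : |x - y| ≤ 2 * B := by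
  have := abs_sub x y
  linarith

/-- AIPW sensitivity lemma, complete-mean aggregation case (Lemma F.2). -/
theorem stmt_11 {𝒳 : Type*} (n K : ℕ) (hn : 1 ≤ n) (hK : 2 ≤ K)
    (fold : Fin n → Fin K) (i₀ : Fin n) (Bμ Bπ : ℝ) (hBμ : 0 ≤ Bμ) (hBπ : 1 ≤ Bπ)
    (X X' : Fin n → 𝒳) (A A' Y Y' : Fin n → ℝ)
    (hA : ∀ i, A i = 0 ∨ A i = 1) (hA' : ∀ i, A' i = 0 ∨ A' i = 1)
    (hY : ∀ i, |Y i| ≤ Bμ) (hY' : ∀ i, |Y' i| ≤ Bμ)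
    (hXag : ∀ i, i ≠ i₀ → X i = X' i)
    (hAag : ∀ i, i ≠ i₀ → A i = A' i)
    (hYag : ∀ i, i ≠ i₀ → Y i = Y' i)
    (μ0 μ1 μ0' μ1' : Fin K → 𝒳 → ℝ)
    (hb0 : ∀ k x, |μ0 k x| ≤ Bμ) (hb1 : ∀ k x, |μ1 k x| ≤ Bμ)
    (hb0' : ∀ k x, |μ0' k x| ≤ Bμ) (hb1' : ∀ k x, |μ1' k x| ≤ Bμ)
    (π π' : Fin K → 𝒳 → ℝ)
    (hπ01 : ∀ k x, 0 < π k x ∧ π k x < 1) (hπ01' : ∀ k x, 0 < π' k x ∧ π' k x < 1)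
    (hπB : ∀ k x, 1 / π k x ≤ Bπ ∧ 1 / (1 - π k x) ≤ Bπ)
    (hπB' : ∀ k x, 1 / π' k x ≤ Bπ ∧ 1 / (1 - π' k x) ≤ Bπ)
    (hag0 : ∀ k, k ≠ fold i₀ → μ0 k = μ0' k)
    (hag1 : ∀ k, k ≠ fold i₀ → μ1 k = μ1' k)
    (hπag : ∀ k, k ≠ fold i₀ → π k = π' k)
    (M0 M1 W0 W1 M0' M1' W0' W1' : Fin n → ℝ)
    (hM0 : ∀ i, M0 i = (1 / ((K : ℝ) - 1)) * ∑ k ∈ univ.erase (fold i), μ0 k (X i))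
    (hM1 : ∀ i, M1 i = (1 / ((K : ℝ) - 1)) * ∑ k ∈ univ.erase (fold i), μ1 k (X i))
    (hW1 : ∀ i, W1 i = (1 / ((K : ℝ) - 1)) * ∑ k ∈ univ.erase (fold i), 1 / π k (X i))
    (hW0 : ∀ i, W0 i = (1 / ((K : ℝ) - 1)) * ∑ k ∈ univ.erase (fold i), 1 / (1 - π k (X i)))
    (hM0' : ∀ i, M0' i = (1 / ((K : ℝ) - 1)) * ∑ k ∈ univ.erase (fold i), μ0' k (X' i))
    (hM1' : ∀ i, M1' i = (1 / ((K : ℝ) - 1)) * ∑ k ∈ univ.erase (fold i), μ1' k (X' i))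
    (hW1' : ∀ i, W1' i = (1 / ((K : ℝ) - 1)) * ∑ k ∈ univ.erase (fold i), 1 / π' k (X' i))
    (hW0' : ∀ i, W0' i = (1 / ((K : ℝ) - 1)) * ∑ k ∈ univ.erase (fold i), 1 / (1 - π' k (X' i)))
    (Γ Γ' : Fin n → ℝ)
    (hΓ : ∀ i, Γ i =
      M1 i - M0 i + A i * (Y i - M1 i) * W1 i - (1 - A i) * (Y i - M0 i) * W0 i)
    (hΓ' : ∀ i, Γ' i =
      M1' i - M0' i + A' i * (Y' i - M1' i) * W1' i - (1 - A' i) * (Y' i - M0' i) * W0' i) :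
    (∀ j, fold j = fold i₀ → j ≠ i₀ → Γ j = Γ' j) ∧
    |Γ i₀ - Γ' i₀| ≤ 4 * Bμ * (1 + Bπ) ∧
    (∀ j, fold j ≠ fold i₀ → |Γ j - Γ' j| ≤ 4 * Bμ * (1 + Bπ) / ((K : ℝ) - 1)) ∧
    |(1 / (n : ℝ)) * ∑ i, Γ i - (1 / (n : ℝ)) * ∑ i, Γ' i|
      ≤ 4 * Bμ * (1 + Bπ) * (1 / (n : ℝ) + 1 / ((K : ℝ) - 1)) := by
  have hK' : (2 : ℝ) ≤ K := by exact_mod_cast hK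
  have hK1 : (0 : ℝ) < (K : ℝ) - 1 := by linarith
  have hn' : (1 : ℝ) ≤ n := by exact_mod_cast hn
  have hC : 0 ≤ 4 * Bμ * (1 + Bπ) := by positivity
  have c1 : ∀ j, fold j = fold i₀ → j ≠ i₀ → Γ j = Γ' j := by
    intro j hj hne
    have hk : ∀ k ∈ univ.erase (fold j), k ≠ fold i₀ := by
      intro k hk
      rw [← hj]
      exact Finset.ne_of_mem_erase hk
    have e0 : M0 j = M0' j := by
      rw [hM0, hM0', hXag j hne]
      congr 1
      exact Finset.sum_congr rfl fun k h => by rw [hag0 k (hk k h)]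
    have e1 : M1 j = M1' j := by
      rw [hM1, hM1', hXag j hne]
      congr 1
      exact Finset.sum_congr rfl fun k h => by rw [hag1 k (hk k h)]
    have e2 : W0 j = W0' j := by
      rw [hW0, hW0', hXag j hne]
      congr 1
      exact Finset.sum_congr rfl fun k h => by rw [hπag k (hk k h)]
    have e3 : W1 j = W1' j := by
      rw [hW1, hW1', hXag j hne]
      congr 1
      exact Finset.sum_congr rfl fun k h => by rw [hπag k (hk k h)]
    rw [hΓ, hΓ', e0, e1, e2, e3, hAag j hne, hYag j hne]
  have bM0 : ∀ i, |M0 i| ≤ Bμ := fun i => by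
    rw [hM0]; exact avg_abs K hK _ _ _ fun k => hb0 k _
  have bM1 : ∀ i, |M1 i| ≤ Bμ := fun i => by
    rw [hM1]; exact avg_abs K hK _ _ _ fun k => hb1 k _
  have bM0' : ∀ i, |M0' i| ≤ Bμ := fun i => by
    rw [hM0']; exact avg_abs K hK _ _ _ fun k => hb0' k _
  have bM1' : ∀ i, |M1' i| ≤ Bμ := fun i => by
    rw [hM1']; exact avg_abs K hK _ _ _ fun k => hb1' k _
  have bW0 : ∀ i, |W0 i| ≤ Bπ := fun i => by
    rw [hW0]
    exact avg_abs K hK _ _ _ fun k => inv_abs _ _ (sub_pos.2 (hπ01 k _).2) (hπB k _).2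
  have bW1 : ∀ i, |W1 i| ≤ Bπ := fun i => by
    rw [hW1]
    exact avg_abs K hK _ _ _ fun k => inv_abs _ _ (hπ01 k _).1 (hπB k _).1
  have bW0' : ∀ i, |W0' i| ≤ Bπ := fun i => by
    rw [hW0']
    exact avg_abs K hK _ _ _ fun k => inv_abs _ _ (sub_pos.2 (hπ01' k _).2) (hπB' k _).2
  have bW1' : ∀ i, |W1' i| ≤ Bπ := fun i => by
    rw [hW1']
    exact avg_abs K hK _ _ _ fun k => inv_abs _ _ (hπ01' k _).1 (hπB' k _).1
  have c2 : |Γ i₀ - Γ' i₀| ≤ 4 * Bμ * (1 + Bπ) := by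
    have g := score_abs Bμ Bπ _ _ _ _ _ _ (hA i₀) (hY i₀) (bM0 i₀) (bM1 i₀) (bW0 i₀) (bW1 i₀)
    have g' := score_abs Bμ Bπ _ _ _ _ _ _ (hA' i₀) (hY' i₀) (bM0' i₀) (bM1' i₀) (bW0' i₀)
      (bW1' i₀)
    rw [← hΓ] at g
    rw [← hΓ'] at g'
    have := abs_sub (Γ i₀) (Γ' i₀)
    linarith
  have c3 : ∀ j, fold j ≠ fold i₀ → |Γ j - Γ' j| ≤ 4 * Bμ * (1 + Bπ) / ((K : ℝ) - 1) := by
    intro j hj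
    have hne : j ≠ i₀ := fun h => hj (by rw [h])
    have d0 : |M0 j - M0' j| ≤ 2 * Bμ / ((K : ℝ) - 1) := by
      rw [hM0, hM0', hXag j hne]
      exact avg_diff K hK _ (fold i₀) _ _ _ (by positivity) (fun k hk => by rw [hag0 k hk])
        (bd_diff _ _ _ (hb0 _ _) (hb0' _ _))
    have d1 : |M1 j - M1' j| ≤ 2 * Bμ / ((K : ℝ) - 1) := by
      rw [hM1, hM1', hXag j hne]
      exact avg_diff K hK _ (fold i₀) _ _ _ (by positivity) (fun k hk => by rw [hag1 k hk])
        (bd_diff _ _ _ (hb1 _ _) (hb1' _ _))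
    have e0 : |W0 j - W0' j| ≤ Bπ / ((K : ℝ) - 1) := by
      rw [hW0, hW0', hXag j hne]
      exact avg_diff K hK _ (fold i₀) _ _ _ (by positivity) (fun k hk => by rw [hπag k hk])
        (inv_diff _ _ _ (sub_pos.2 (hπ01 _ _).2) (hπB _ _).2 (sub_pos.2 (hπ01' _ _).2)
          (hπB' _ _).2)
    have e1 : |W1 j - W1' j| ≤ Bπ / ((K : ℝ) - 1) := by
      rw [hW1, hW1', hXag j hne]
      exact avg_diff K hK _ (fold i₀) _ _ _ (by positivity) (fun k hk => by rw [hπag k hk])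
        (inv_diff _ _ _ (hπ01 _ _).1 (hπB _ _).1 (hπ01' _ _).1 (hπB' _ _).1)
    rw [div_eq_mul_inv] at d0 d1 e0 e1 ⊢
    rw [hΓ, hΓ', ← hAag j hne, ← hYag j hne]
    exact score_diff Bμ Bπ _ _ _ _ _ _ _ _ _ _ _ (hA j) (hY j) (bM0 j) (bM1 j) (bW0' j) (bW1' j)
      d0 d1 e0 e1
  refine ⟨c1, c2, c3, ?_⟩
  have c4 : ∀ i ∈ univ.erase i₀, |Γ i - Γ' i| ≤ 4 * Bμ * (1 + Bπ) / ((K : ℝ) - 1) := by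
    intro i hi
    by_cases h : fold i = fold i₀
    · rw [c1 i h (Finset.ne_of_mem_erase hi), sub_self, abs_zero]
      positivity
    · exact c3 i h
  have hE : 0 ≤ 4 * Bμ * (1 + Bπ) / ((K : ℝ) - 1) := by positivity
  have c5 : |∑ i, (Γ i - Γ' i)| ≤
      4 * Bμ * (1 + Bπ) + n * (4 * Bμ * (1 + Bπ) / ((K : ℝ) - 1)) := by
    refine (Finset.abs_sum_le_sum_abs _ _).trans ?_
    rw [← Finset.add_sum_erase _ _ (Finset.mem_univ i₀)]
    refine add_le_add c2 ((Finset.sum_le_card_nsmul _ _ _ c4).trans ?_)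
    rw [nsmul_eq_mul]
    gcongr
    exact (Finset.card_erase_le).trans (by simp)
  rw [← mul_sub, ← Finset.sum_sub_distrib, abs_mul,
    abs_of_pos (by positivity : (0 : ℝ) < 1 / (n : ℝ)), one_div_mul_eq_div,
    div_le_iff₀ (by linarith)]
  refine c5.trans (le_of_eq ?_)
  have : (n : ℝ) ≠ 0 := by positivity
  field_simp
end

section
/- Fix integers n ≥ 1, K ≥ 2, a partition of {1,…,n} into folds I_1,…,I_K with fold map k(·), an index i₀ ∈ I_1, and a real B_μ ≥ 0. Let 𝒳 be a set, let X_i, X'_i ∈ 𝒳 with X_j = X'_j for all j ≠ i₀, and for each k ∈ {1,…,K} let Γ^{(k)}_−, Γ^{(k)}_+, Γ'^{(k)}_−, Γ'^{(k)}_+ : 𝒳 → [−2B_μ, 2B_μ] with Γ^{(k)}_± = Γ'^{(k)}_± for all k ≠ 1. Define Γ_{i,±} = (1/(K−1)) Σ_{k≠k(i)} Γ^{(k)}_±(X_i) and the endpoint averages m_± = (1/n) Σ_{i=1}^n Γ_{i,±}, and define the primed analogues m'_± from X'_i and Γ'^{(k)}_±. Then |m_± − m'_±| ≤ 4B_μ·(1/n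 + 1/(K−1)) for each sign. -/
open Finset

theorem aux_sens {𝒳 : Type*} (n K : ℕ) (hn : 1 ≤ n) (hK : 2 ≤ K)
    (fold : Fin n → Fin K) (i₀ : Fin n) (B : ℝ) (hB : 0 ≤ B)
    (X X' : Fin n → 𝒳) (hX : ∀ j, j ≠ i₀ → X j = X' j)
    (G G' : Fin K → 𝒳 → ℝ)
    (hb : ∀ k x, |G k x| ≤ 2 * B) (hb' : ∀ k x, |G' k x| ≤ 2 * B)
    (hag : ∀ k, k ≠ fold i₀ → G k = G' k) :
    |(1 / (n : ℝ)) * ∑ i, (1 / ((K : ℝ) - 1)) * ∑ k ∈ univ.erase (fold i), G k (X i)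
        - (1 / (n : ℝ)) * ∑ i, (1 / ((K : ℝ) - 1)) * ∑ k ∈ univ.erase (fold i), G' k (X' i)|
      ≤ 4 * B * (1 / (n : ℝ) + 1 / ((K : ℝ) - 1)) := by
  have hn' : (0 : ℝ) < n := by exact_mod_cast hn
  have hK2 : (2 : ℝ) ≤ K := by exact_mod_cast hK
  have hK' : (0 : ℝ) < (K : ℝ) - 1 := by linarith
  have key : ∀ i, |∑ k ∈ univ.erase (fold i), (G k (X i) - G' k (X' i))|
      ≤ ((K : ℝ) - 1) * (if i = i₀ then 4 * B else 0) + 4 * B := by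
    intro i
    have h1 : ∀ k ∈ univ.erase (fold i), |G k (X i) - G' k (X' i)|
        ≤ (if i = i₀ then 4 * B else 0) + (if k = fold i₀ then 4 * B else 0) := by
      intro k _
      have h := abs_le.1 (hb k (X i))
      have h' := abs_le.1 (hb' k (X' i))
      have h4 : |G k (X i) - G' k (X' i)| ≤ 4 * B := by
        rw [abs_le]; constructor <;> linarith [h.1, h.2, h'.1, h'.2]
      by_cases hi : i = i₀
      · rw [if_pos hi]
        split_ifs <;> linarith
      · by_cases hk : k = fold i₀
        · rw [if_neg hi, if_pos hk]; linarith
        · rw [if_neg hi, if_neg hk, hag k hk, hX i hi]; simp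
    refine (abs_sum_le_sum_abs _ _).trans ((sum_le_sum h1).trans ?_)
    rw [sum_add_distrib, sum_const, card_erase_of_mem (mem_univ _), card_univ, Fintype.card_fin,
      nsmul_eq_mul, Nat.cast_sub (by omega), Nat.cast_one, sum_ite_eq']
    split_ifs <;> linarith
  rw [← mul_sub, ← sum_sub_distrib]
  simp_rw [← mul_sub, ← sum_sub_distrib]
  rw [← mul_sum, abs_mul, abs_mul, abs_of_pos (by positivity : (0:ℝ) < 1 / n),
    abs_of_pos (by positivity : (0:ℝ) < 1 / ((K : ℝ) - 1))]
  have h2 := (abs_sum_le_sum_abs (fun i => ∑ k ∈ univ.erase (fold i), (G k (X i) - G' k (X' i)))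
    univ).trans (sum_le_sum fun i _ => key i)
  rw [sum_add_distrib, ← mul_sum, sum_ite_eq', if_pos (mem_univ _), sum_const, card_univ,
    Fintype.card_fin, nsmul_eq_mul] at h2
  calc _ ≤ 1 / (n : ℝ) * (1 / ((K : ℝ) - 1) * (((K : ℝ) - 1) * (4 * B) + n * (4 * B))) := by
        gcongr
    _ = _ := by
        field_simp

/-- Sensitivity of the averaged lower/upper confidence-interval endpoints
(privacy part of Theorem 4.3). -/
theorem stmt_14 {𝒳 : Type*} (n K : ℕ) (hn : 1 ≤ n) (hK : 2 ≤ K)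
    (fold : Fin n → Fin K) (i₀ : Fin n) (Bμ : ℝ) (hBμ : 0 ≤ Bμ)
    (X X' : Fin n → 𝒳) (hX : ∀ j, j ≠ i₀ → X j = X' j)
    (Γlo Γhi Γlo' Γhi' : Fin K → 𝒳 → ℝ)
    (hblo : ∀ k x, |Γlo k x| ≤ 2 * Bμ) (hbhi : ∀ k x, |Γhi k x| ≤ 2 * Bμ)
    (hblo' : ∀ k x, |Γlo' k x| ≤ 2 * Bμ) (hbhi' : ∀ k x, |Γhi' k x| ≤ 2 * Bμ)
    (haglo : ∀ k, k ≠ fold i₀ → Γlo k = Γlo' k)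
    (haghi : ∀ k, k ≠ fold i₀ → Γhi k = Γhi' k) :
    |(1 / (n : ℝ)) * ∑ i, (1 / ((K : ℝ) - 1)) * ∑ k ∈ univ.erase (fold i), Γlo k (X i)
        - (1 / (n : ℝ)) * ∑ i, (1 / ((K : ℝ) - 1)) * ∑ k ∈ univ.erase (fold i), Γlo' k (X' i)|
      ≤ 4 * Bμ * (1 / (n : ℝ) + 1 / ((K : ℝ) - 1)) ∧
    |(1 / (n : ℝ)) * ∑ i, (1 / ((K : ℝ) - 1)) * ∑ k ∈ univ.erase (fold i), Γhi k (X i)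
        - (1 / (n : ℝ)) * ∑ i, (1 / ((K : ℝ) - 1)) * ∑ k ∈ univ.erase (fold i), Γhi' k (X' i)|
      ≤ 4 * Bμ * (1 / (n : ℝ) + 1 / ((K : ℝ) - 1)) := by
  exact ⟨aux_sens n K hn hK fold i₀ Bμ hBμ X X' hX Γlo Γlo' hblo hblo' haglo,
    aux_sens n K hn hK fold i₀ Bμ hBμ X X' hX Γhi Γhi' hbhi hbhi' haghi⟩
end
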